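/- For every ε > 0 there exists a constant C = C(ε) > 0 such that for all integers m ≥ 2, all reals x, y with m ≥ x ≥ m^{1/2} and m ≥ y ≥ 1, and every integer a with gcd(a,m) = 1, the quantity T₄(a;x,y), the number of quintuples (p₁, p₂, p₃, p₄, v) with p₁, p₂, p₃, p₄ primes ≤ x coprime to m, v an integer with 1 ≤ v ≤ y, and a·p₁⁻¹·p₂⁻¹·p₃⁻¹·p₄⁻¹ ≡ v (mod m), satisfies |T₄(a;x,y) − π(x)⁴·y/m| ≤ C·x^{4+ε}·m^{-1/2}. -/

import Mathlib

/-- The multiplicative inverse modulo `m` of `n`, as a natural number in `[0, m)`. -/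
noncomputable def minv (m n : ℕ) : ℕ := ((n : ZMod m)⁻¹).val

/-- The prime counting function `π(x)`. -/
noncomputable def primePi (x : ℝ) : ℕ := {p : ℕ | p.Prime ∧ (p : ℝ) ≤ x}.ncard

/-- `T₄(a; x, y)`: the number of quintuples `(p₁, p₂, p₃, p₄, v)` with `p₁, …, p₄` primes at
most `x` coprime to `m`, `1 ≤ v ≤ y`, and `a · p₁⁻¹ · p₂⁻¹ · p₃⁻¹ · p₄⁻¹ ≡ v (mod m)`. -/
noncomputable def T4 (m : ℕ) (a : ℤ) (x y : ℝ) : ℕ :=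
  {t : ℕ × ℕ × ℕ × ℕ × ℕ | t.1.Prime ∧ t.2.1.Prime ∧ t.2.2.1.Prime ∧ t.2.2.2.1.Prime ∧
    (t.1 : ℝ) ≤ x ∧ (t.2.1 : ℝ) ≤ x ∧ (t.2.2.1 : ℝ) ≤ x ∧ (t.2.2.2.1 : ℝ) ≤ x ∧
    Nat.Coprime t.1 m ∧ Nat.Coprime t.2.1 m ∧ Nat.Coprime t.2.2.1 m ∧
    Nat.Coprime t.2.2.2.1 m ∧
    1 ≤ t.2.2.2.2 ∧ (t.2.2.2.2 : ℝ) ≤ y ∧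
    a * (minv m t.1 : ℤ) * (minv m t.2.1 : ℤ) * (minv m t.2.2.1 : ℤ) *
      (minv m t.2.2.2.1 : ℤ) ≡ (t.2.2.2.2 : ℤ) [ZMOD (m : ℤ)]}.ncard


lemma tau_bound (δ : ℝ) (hδ : 0 < δ) : ∃ C : ℝ, 0 < C ∧ ∀ m : ℕ, m ≠ 0 →
    (m.divisors.card : ℝ) ≤ C * (m : ℝ) ^ δ := by
  set K : ℝ := 1 + 1 / (δ * Real.log 2) with hK
  have hl2 : 0 < Real.log 2 := Real.log_pos (by norm_num)
  have hK1 : 1 ≤ K := by rw [hK]; have : 0 < 1 / (δ * Real.log 2) := by positivity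
                         linarith
  obtain ⟨B, hB⟩ := exists_nat_ge ((2 : ℝ) ^ (1 / δ))
  refine ⟨K ^ B, by positivity, fun m hm => ?_⟩
  have hm' : (m : ℝ) ^ δ = ∏ p ∈ m.primeFactors, ((p : ℝ) ^ δ) ^ (m.factorization p) := by
    conv_lhs => rw [← Nat.prod_factorization_pow_eq_self hm]
    rw [Finsupp.prod, Nat.support_factorization]
    push_cast
    rw [← Real.finsetProd_rpow _ _ (fun i _ => by positivity)]
    refine Finset.prod_congr rfl fun p _ => ?_
    rw [← Real.rpow_natCast, ← Real.rpow_natCast, ← Real.rpow_mul (by positivity),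
      ← Real.rpow_mul (by positivity), mul_comm]
  have hc : ∏ p ∈ m.primeFactors, (if p < B then K else 1) ≤ K ^ B := by
    rw [Finset.prod_ite]
    simp only [Finset.prod_const, one_pow, mul_one]
    refine pow_le_pow_right₀ hK1 ?_
    calc _ ≤ (Finset.range B).card := Finset.card_le_card (by
            intro p hp; simp at hp ⊢; exact hp.2)
      _ = B := by simp
  rw [Nat.card_divisors hm, hm']
  push_cast
  calc _ ≤ ∏ p ∈ m.primeFactors, ((if p < B then K else 1) * ((p : ℝ) ^ δ) ^ (m.factorization p)) := by
        refine Finset.prod_le_prod (fun _ _ => by positivity) fun p hp => ?_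
        have hp2 : 2 ≤ p := (Nat.prime_of_mem_primeFactors hp).two_le
        have hp2' : (2 : ℝ) ≤ p := by exact_mod_cast hp2
        set k := m.factorization p
        split_ifs with h
        · have h1 : 1 + δ * Real.log 2 ≤ (p : ℝ) ^ δ := by
            calc 1 + δ * Real.log 2 ≤ Real.exp (Real.log 2 * δ) := by
                  have := Real.add_one_le_exp (Real.log 2 * δ); linarith
              _ = (2 : ℝ) ^ δ := by rw [Real.rpow_def_of_pos (by norm_num)]
              _ ≤ _ := Real.rpow_le_rpow (by norm_num) hp2' hδ.le
          have h2 : 1 + k * (δ * Real.log 2) ≤ ((p : ℝ) ^ δ) ^ k := by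
            refine (one_add_mul_le_pow (by nlinarith [mul_pos hδ hl2]) k).trans ?_
            gcongr
          have h3 : (k : ℝ) + 1 ≤ K * (1 + k * (δ * Real.log 2)) := by
            have e : K * (1 + k * (δ * Real.log 2)) = 1 + 1 / (δ * Real.log 2) + k * (δ * Real.log 2) + k := by
              rw [hK]; field_simp; ring
            rw [e]
            have : 0 < 1 / (δ * Real.log 2) := by positivity
            have : 0 ≤ k * (δ * Real.log 2) := by positivity
            linarith
          refine h3.trans ?_
          gcongr
        · have h1 : (2 : ℝ) ≤ (p : ℝ) ^ δ := by
            have : (2 : ℝ) ^ (1 / δ) ≤ p := hB.trans (by exact_mod_cast not_lt.1 h)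
            calc (2 : ℝ) = ((2 : ℝ) ^ (1 / δ)) ^ δ := by
                  rw [← Real.rpow_mul (by norm_num)]; field_simp; simp
              _ ≤ _ := Real.rpow_le_rpow (by positivity) this hδ.le
          rw [one_mul]
          calc (k : ℝ) + 1 ≤ 2 ^ k := by exact_mod_cast Nat.lt_two_pow_self
            _ ≤ _ := by gcongr
    _ = _ := Finset.prod_mul_distrib
    _ ≤ _ := by gcongr

lemma gcd_sum (m : ℕ) (hm : 2 ≤ m) :
    ∑ n ∈ Finset.Ico 1 m, (Nat.gcd n m : ℝ) / n ≤ m.divisors.card * (1 + Real.log m) := by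
  have hh : ∑ k ∈ Finset.Icc 1 m, (1 : ℝ) / k ≤ 1 + Real.log m := by
    have := harmonic_le_one_add_log m
    rw [harmonic_eq_sum_Icc] at this
    push_cast at this
    simpa using this
  calc _ = ∑ n ∈ Finset.Ico 1 m, (1 : ℝ) / ((n / Nat.gcd n m : ℕ) : ℝ) := by
        refine Finset.sum_congr rfl fun n hn => ?_
        rw [Nat.cast_div_charZero (Nat.gcd_dvd_left n m)]
        simp
    _ = ∑ z ∈ (Finset.Ico 1 m).image (fun n => (Nat.gcd n m, n / Nat.gcd n m)), (1 : ℝ) / (z.2 : ℝ) := by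
        rw [Finset.sum_image]
        intro n hn n' hn' h
        simp only [Prod.mk.injEq] at h
        rw [← Nat.div_mul_cancel (Nat.gcd_dvd_left n m), ← Nat.div_mul_cancel (Nat.gcd_dvd_left n' m), h.2, h.1]
    _ ≤ ∑ z ∈ m.divisors ×ˢ Finset.Icc 1 m, (1 : ℝ) / (z.2 : ℝ) := by
        refine Finset.sum_le_sum_of_subset_of_nonneg ?_ (fun _ _ _ => by positivity)
        intro z hz
        simp only [Finset.mem_image, Finset.mem_Ico] at hz
        obtain ⟨n, ⟨h1, h2⟩, rfl⟩ := hz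
        have := Nat.gcd_pos_of_pos_left m h1
        simp only [Finset.mem_product, Nat.mem_divisors, Finset.mem_Icc]
        refine ⟨⟨Nat.gcd_dvd_right _ _, by omega⟩, ?_, ?_⟩
        · exact Nat.div_pos (Nat.gcd_le_left _ h1) this
        · exact (Nat.div_le_self _ _).trans h2.le
    _ = m.divisors.card * ∑ k ∈ Finset.Icc 1 m, (1 : ℝ) / k := by
        rw [Finset.sum_product]; simp
    _ ≤ _ := by gcongr

lemma gcd_sum' (m : ℕ) (hm : 2 ≤ m) :
    ∑ n ∈ Finset.Ico 1 m, (Nat.gcd n m : ℝ) / (m - n : ℝ) ≤ m.divisors.card * (1 + Real.log m) := by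
  refine le_trans (le_of_eq ?_) (gcd_sum m hm)
  refine Finset.sum_bij' (fun n _ => m - n) (fun n _ => m - n) ?_ ?_ ?_ ?_ ?_
  · intro n hn; simp at hn ⊢; omega
  · intro n hn; simp at hn ⊢; omega
  · intro n hn; simp at hn ⊢; omega
  · intro n hn; simp at hn ⊢; omega
  · intro n hn
    simp at hn
    rw [Nat.cast_sub hn.2.le, Nat.gcd_comm (m-n), Nat.gcd_self_sub_right hn.2.le, Nat.gcd_comm]

open ZMod in
lemma geo_bound (m : ℕ) [NeZero m] (n : ℕ) (h1 : 1 ≤ n) (h2 : n < m) (Y : ℕ) :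
    ‖∑ v ∈ Finset.Icc 1 Y, stdAddChar (-((n : ZMod m) * (v : ZMod m)))‖ ≤
      m / 2 * (1 / n + 1 / (m - n)) := by
  set z : ℂ := stdAddChar (-(n : ZMod m)) with hz
  have hnz : ‖z‖ = 1 := AddChar.norm_apply _ _
  have hm0 : (0 : ℝ) < m := by exact_mod_cast (by omega : 0 < m)
  have hn0 : (0 : ℝ) < n := by exact_mod_cast h1
  have hmn : (n : ℝ) < m := by exact_mod_cast h2
  have hterm : ∀ v : ℕ, stdAddChar (-((n : ZMod m) * (v : ZMod m))) = z ^ v := by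
    intro v
    rw [hz, ← AddChar.map_nsmul_eq_pow]
    congr 1; simp; ring
  simp_rw [hterm]
  have hzn : ‖z - 1‖ = 2 * Real.sin (Real.pi * n / m) := by
    have : z = Complex.exp (Complex.I * ((-(2 * Real.pi * n / m) : ℝ) : ℂ)) := by
      rw [hz]
      have := ZMod.stdAddChar_coe (N := m) (-(n : ℤ))
      push_cast at this
      rw [this]
      congr 1; push_cast; ring
    rw [this, Complex.norm_exp_I_mul_ofReal_sub_one]
    have e : -(2 * Real.pi * n / m) / 2 = - (Real.pi * n / m) := by ring
    rw [e, Real.sin_neg, mul_neg, norm_neg, Real.norm_of_nonneg]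
    have := Real.sin_nonneg_of_nonneg_of_le_pi (x := Real.pi * n / m) (by positivity)
      (by rw [div_le_iff₀ hm0]; gcongr)
    linarith
  have hs : 2 * min (n : ℝ) (m - n) / m ≤ Real.sin (Real.pi * n / m) := by
    rcases le_total (n : ℝ) (m - n) with h | h
    · rw [min_eq_left h]
      have := Real.mul_le_sin (x := Real.pi * n / m) (by positivity)
        (by rw [div_le_iff₀ hm0]; nlinarith [Real.pi_pos])
      refine le_trans (le_of_eq ?_) this
      field_simp
    · rw [min_eq_right h]
      have := Real.mul_le_sin (x := Real.pi * (m - n) / m)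
        (by have : (0:ℝ) ≤ m - n := by linarith
            positivity)
        (by rw [div_le_iff₀ hm0]; nlinarith [Real.pi_pos])
      rw [show Real.pi * n / m = Real.pi - Real.pi * (m - n) / m by field_simp; ring, Real.sin_pi_sub]
      refine le_trans (le_of_eq ?_) this
      field_simp
  have hmin : 0 < min (n : ℝ) (m - n) := lt_min hn0 (by linarith)
  have hspos : 0 < Real.sin (Real.pi * n / m) := lt_of_lt_of_le (by positivity) hs
  have hz1 : z ≠ 1 := by
    intro h; rw [h] at hzn; simp at hzn; linarith
  have hsum : ∑ v ∈ Finset.Icc 1 Y, z ^ v = z * ((z ^ Y - 1) / (z - 1)) := by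
    rw [← geom_sum_eq hz1, Finset.mul_sum, ← Finset.Ico_add_one_right_eq_Icc, Finset.sum_Ico_eq_sum_range]
    simp [pow_add]
  rw [hsum, norm_mul, hnz, one_mul, norm_div, hzn]
  have h3 : ‖z ^ Y - 1‖ ≤ 2 := by
    refine (norm_sub_le _ _).trans ?_
    rw [norm_pow, hnz]; norm_num
  calc _ ≤ 2 / (2 * (2 * min (n : ℝ) (m - n) / m)) := by gcongr
    _ = m / 2 * (1 / min (n : ℝ) (m - n)) := by field_simp
    _ ≤ _ := by
      gcongr
      rcases min_choice (n : ℝ) (m - n) with h | h <;> rw [h]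
      · have : 0 ≤ 1 / ((m:ℝ) - n) := by apply div_nonneg <;> linarith
        linarith
      · have : 0 ≤ 1 / (n:ℝ) := by positivity
        linarith
open ZMod in
lemma bilin (m : ℕ) [NeZero m] (r : ZMod m → ℝ) (c : ZMod m) (d : ℕ)
    (hd : (Finset.univ.filter (fun t : ZMod m => c * t = 0)).card ≤ d) :
    ‖∑ w, ∑ u, (r w : ℂ) * (r u : ℂ) * stdAddChar (c * w * u)‖ ^ 2 ≤ m * d * (∑ w, r w ^ 2) ^ 2 := by
  set F : ZMod m → ℂ := fun w => ∑ u, (r u : ℂ) * stdAddChar (c * w * u) with hF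
  have h1 : ‖∑ w, ∑ u, (r w : ℂ) * (r u : ℂ) * stdAddChar (c * w * u)‖ ≤ ∑ w, |r w| * ‖F w‖ := by
    refine (norm_sum_le _ _).trans (Finset.sum_le_sum fun w _ => ?_)
    rw [← Real.norm_eq_abs, ← Complex.norm_real, ← norm_mul, hF, Finset.mul_sum]
    simp_rw [mul_assoc]; rfl
  have h2 : (∑ w, |r w| * ‖F w‖) ^ 2 ≤ (∑ w, r w ^ 2) * ∑ w, ‖F w‖ ^ 2 := by
    refine (Finset.sum_mul_sq_le_sq_mul_sq _ _ _).trans (le_of_eq ?_)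
    simp
  have h3 : ((∑ w, ‖F w‖ ^ 2 : ℝ) : ℂ) =
      ((∑ u, ∑ u', r u * r u' * (if c * (u - u') = 0 then (m : ℝ) else 0) : ℝ) : ℂ) := by
    push_cast
    have e : ∀ w, ((‖F w‖ : ℂ)) ^ 2 =
        ∑ u, ∑ u', (r u : ℂ) * (r u' : ℂ) * stdAddChar (w * (c * (u - u'))) := by
      intro w
      rw [← Complex.mul_conj', hF]
      simp only [map_sum, map_mul, Complex.conj_ofReal]
      rw [Finset.sum_mul_sum]
      refine Finset.sum_congr rfl fun u _ => Finset.sum_congr rfl fun u' _ => ?_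
      rw [← AddChar.map_neg_eq_conj]
      rw [show w * (c * (u - u')) = c * w * u + -(c * w * u') by ring, AddChar.map_add_eq_mul]
      ring
    simp_rw [e]
    rw [Finset.sum_comm]
    refine Finset.sum_congr rfl fun u _ => ?_
    rw [Finset.sum_comm]
    refine Finset.sum_congr rfl fun u' _ => ?_
    rw [← Finset.mul_sum, AddChar.sum_mulShift _ (isPrimitive_stdAddChar m), ZMod.card]
    split_ifs <;> simp
  have h3' := Complex.ofReal_injective h3
  have hcnt : ∀ u : ZMod m, ∑ u', (if c * (u - u') = 0 then (m : ℝ) else 0) ≤ m * d := by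
    intro u
    rw [← Finset.sum_filter, Finset.sum_const, nsmul_eq_mul, mul_comm]
    gcongr
    refine le_trans ?_ hd
    refine Finset.card_le_card_of_injOn (fun u' => u - u') ?_ ?_
    · intro t ht; simpa using ht
    · intro t _ t' _ h; simpa using h
  have hcnt' : ∀ u : ZMod m, ∑ u', (if c * (u' - u) = 0 then (m : ℝ) else 0) ≤ m * d := by
    intro u
    refine le_trans (le_of_eq ?_) (hcnt u)
    refine Finset.sum_congr rfl fun u' _ => ?_
    have e : c * (u' - u) = 0 ↔ c * (u - u') = 0 := by
      rw [show c * (u' - u) = - (c * (u - u')) by ring, neg_eq_zero]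
    simp only [e]
  have h4 : ∑ w, ‖F w‖ ^ 2 ≤ m * d * ∑ w, r w ^ 2 := by
    rw [h3']
    calc _ ≤ ∑ u, ∑ u', ((r u ^ 2 / 2) * (if c * (u - u') = 0 then (m : ℝ) else 0) +
            (r u' ^ 2 / 2) * (if c * (u - u') = 0 then (m : ℝ) else 0)) := by
          refine Finset.sum_le_sum fun u _ => Finset.sum_le_sum fun u' _ => ?_
          rw [← add_mul]
          have : (0 : ℝ) ≤ (if c * (u - u') = 0 then (m : ℝ) else 0) := by split_ifs <;> positivity
          refine mul_le_mul_of_nonneg_right ?_ this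
          nlinarith [sq_nonneg (r u - r u')]
      _ = (∑ u, (r u ^ 2 / 2) * ∑ u', (if c * (u - u') = 0 then (m : ℝ) else 0)) +
            ∑ u', (r u' ^ 2 / 2) * ∑ u, (if c * (u - u') = 0 then (m : ℝ) else 0) := by
          simp_rw [Finset.sum_add_distrib, ← Finset.mul_sum]
          congr 1
          rw [Finset.sum_comm]
          simp_rw [← Finset.mul_sum]
      _ ≤ (∑ u, (r u ^ 2 / 2) * (m * d)) + ∑ u', (r u' ^ 2 / 2) * (m * d) := by
          gcongr with u _ u _
          · exact hcnt u
          · exact hcnt' u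
      _ = _ := by
          rw [← Finset.sum_mul, ← Finset.sum_div]; ring
  calc _ ≤ (∑ w, |r w| * ‖F w‖) ^ 2 := by gcongr
    _ ≤ _ := h2
    _ ≤ (∑ w, r w ^ 2) * (m * d * ∑ w, r w ^ 2) := by
        refine mul_le_mul_of_nonneg_left h4 (Finset.sum_nonneg fun _ _ => sq_nonneg _)
    _ = _ := by ring

open ZMod in
lemma bilin' {ι : Type*} (m : ℕ) [NeZero m] (Q : Finset ι) (g : ι → ZMod m) (R : ℝ)
    (hR : ∀ w, ((Q.filter (fun i => g i = w)).card : ℝ) ≤ R) (c : ZMod m) (d : ℕ)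
    (hd : (Finset.univ.filter (fun t : ZMod m => c * t = 0)).card ≤ d) :
    ‖∑ i ∈ Q, ∑ j ∈ Q, stdAddChar (c * g i * g j)‖ ≤ Real.sqrt m * d * (R * Q.card) := by
  set r : ZMod m → ℝ := fun w => ((Q.filter (fun i => g i = w)).card : ℝ) with hr
  have key : ∀ f : ZMod m → ℂ, ∑ i ∈ Q, f (g i) = ∑ w, (r w : ℂ) * f w := by
    intro f
    rw [← Finset.sum_fiberwise Q g]
    refine Finset.sum_congr rfl fun w _ => ?_
    rw [Finset.sum_congr rfl (g := fun _ => f w) (fun i hi => by rw [(Finset.mem_filter.1 hi).2])]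
    simp [hr]
  have h0 : ∑ i ∈ Q, ∑ j ∈ Q, stdAddChar (c * g i * g j) =
      ∑ w, ∑ u, (r w : ℂ) * (r u : ℂ) * stdAddChar (c * w * u) := by
    have e1 : ∀ i ∈ Q, ∑ j ∈ Q, stdAddChar (c * g i * g j) =
        ∑ u, (r u : ℂ) * stdAddChar (c * g i * u) := fun i _ => key (fun u => stdAddChar (c * g i * u))
    rw [Finset.sum_congr rfl e1, key (fun w => ∑ u, (r u : ℂ) * stdAddChar (c * w * u))]
    refine Finset.sum_congr rfl fun w _ => ?_
    rw [Finset.mul_sum]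
    refine Finset.sum_congr rfl fun u _ => ?_
    ring
  have hsum : ∑ w, r w = Q.card := by
    have := key (fun _ => 1)
    simp at this
    exact_mod_cast this.symm
  have hr2 : ∑ w, r w ^ 2 ≤ R * Q.card := by
    rw [← hsum, Finset.mul_sum]
    refine Finset.sum_le_sum fun w _ => ?_
    rw [sq]
    exact mul_le_mul_of_nonneg_right (hR w) (by positivity)
  have hb := bilin m r c d hd
  rw [h0]
  clear_value r
  have hs0 : 0 ≤ ∑ w, r w ^ 2 := Finset.sum_nonneg fun _ _ => sq_nonneg _
  have hd1 : (d : ℝ) ≤ (d : ℝ) ^ 2 := by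
    exact_mod_cast Nat.le_self_pow (by norm_num) d
  have hfin : ‖∑ w, ∑ u, (r w : ℂ) * (r u : ℂ) * stdAddChar (c * w * u)‖ ≤
      Real.sqrt m * d * (∑ w, r w ^ 2) := by
    refine le_of_pow_le_pow_left₀ (two_ne_zero) (mul_nonneg (by positivity) hs0) ?_
    rw [mul_pow, mul_pow, Real.sq_sqrt (by positivity)]
    refine hb.trans ?_
    gcongr
  refine hfin.trans ?_
  gcongr

lemma ann_card (m : ℕ) [NeZero m] (n : ℕ) (b : ZMod m) (hb : IsUnit b) :
    (Finset.univ.filter (fun t : ZMod m => (n : ZMod m) * b * t = 0)).card ≤ Nat.gcd n m := by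
  refine le_trans ?_ (IsAddCyclic.card_nsmul_eq_zero_le (α := ZMod m)
    (Nat.gcd_pos_of_pos_right n (NeZero.pos m)))
  refine Finset.card_le_card fun t ht => ?_
  simp only [Finset.mem_filter, Finset.mem_univ, true_and] at ht ⊢
  rw [gcd_nsmul_eq_zero]
  refine ⟨?_, by simp⟩
  rw [nsmul_eq_mul]
  have : b * (n * t) = 0 := by rw [← ht]; ring
  exact (hb.mul_right_eq_zero).1 this

/-- multiplicative fibre bound -/
lemma fibre (m X : ℕ) [NeZero m] (P : Finset ℕ) (hP : ∀ p ∈ P, p.Prime ∧ p ≤ X ∧ p.Coprime m)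
    (w : ZMod m) :
    ((P ×ˢ P).filter (fun i => ((i.1 : ZMod m)⁻¹ * (i.2 : ZMod m)⁻¹) = w)).card ≤
      2 * (X * X / m + 1) := by
  set s := (P ×ˢ P).filter (fun i => ((i.1 : ZMod m)⁻¹ * (i.2 : ZMod m)⁻¹) = w) with hs
  have hmem : ∀ i ∈ s, (i.1.Prime ∧ i.1 ≤ X ∧ i.1.Coprime m) ∧ (i.2.Prime ∧ i.2 ≤ X ∧ i.2.Coprime m) ∧
      ((i.1 : ZMod m)⁻¹ * (i.2 : ZMod m)⁻¹) = w := by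
    intro i hi
    simp only [hs, Finset.mem_filter, Finset.mem_product] at hi
    exact ⟨hP _ hi.1.1, hP _ hi.1.2, hi.2⟩
  refine (Finset.card_le_mul_card_image (f := fun i : ℕ × ℕ => i.1 * i.2) s 2 ?_).trans ?_
  · intro b hb
    obtain ⟨⟨p, q⟩, hpq, rfl⟩ := Finset.mem_image.1 hb
    refine le_trans (Finset.card_le_card (t := {(p, q), (q, p)}) ?_) Finset.card_le_two
    rintro ⟨p', q'⟩ h
    obtain ⟨h1, h2⟩ := Finset.mem_filter.1 h
    obtain ⟨⟨a1, _, _⟩, ⟨a2, _, _⟩, _⟩ := hmem _ h1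
    obtain ⟨⟨b1, _, _⟩, ⟨b2, _, _⟩, _⟩ := hmem _ hpq
    simp only at a1 a2 b1 b2 h2
    have hdv : p' ∣ p * q := ⟨q', h2.symm⟩
    simp only [Finset.mem_insert, Finset.mem_singleton, Prod.mk.injEq]
    rcases (a1.dvd_mul).1 hdv with h | h
    · have := (Nat.prime_dvd_prime_iff_eq a1 b1).1 h
      subst this
      left; exact ⟨rfl, Nat.eq_of_mul_eq_mul_left a1.pos h2⟩
    · have := (Nat.prime_dvd_prime_iff_eq a1 b2).1 h
      subst this
      right; refine ⟨rfl, Nat.eq_of_mul_eq_mul_left a1.pos ?_⟩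
      rw [h2, mul_comm]
  · refine Nat.mul_le_mul_left 2 ?_
    rw [← Finset.card_range (X * X / m + 1)]
    refine Finset.card_le_card_of_injOn (fun n => n / m) ?_ ?_
    · intro n hn
      obtain ⟨i, hi, rfl⟩ := Finset.mem_image.1 hn
      obtain ⟨⟨_, a1, _⟩, ⟨_, a2, _⟩, _⟩ := hmem _ hi
      simp only [Finset.coe_range, Set.mem_Iio]
      exact Nat.lt_succ_of_le (Nat.div_le_div_right (Nat.mul_le_mul a1 a2))
    · intro n hn n' hn' h
      obtain ⟨i, hi, rfl⟩ := Finset.mem_image.1 hn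
      obtain ⟨j, hj, rfl⟩ := Finset.mem_image.1 hn'
      obtain ⟨⟨_, _, a1⟩, ⟨_, _, a2⟩, a3⟩ := hmem _ hi
      obtain ⟨⟨_, _, b1⟩, ⟨_, _, b2⟩, b3⟩ := hmem _ hj
      have ha1 := ZMod.coe_mul_inv_eq_one _ a1
      have ha2 := ZMod.coe_mul_inv_eq_one _ a2
      have hb1 := ZMod.coe_mul_inv_eq_one _ b1
      have hb2 := ZMod.coe_mul_inv_eq_one _ b2
      have e1 : ((i.1 : ZMod m) * i.2) * w = 1 := by
        rw [← a3]; linear_combination ha1 * (i.2 : ZMod m) * (i.2 : ZMod m)⁻¹ + ha2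
      have e2 : ((j.1 : ZMod m) * j.2) * w = 1 := by
        rw [← b3]; linear_combination hb1 * (j.2 : ZMod m) * (j.2 : ZMod m)⁻¹ + hb2
      have e3 : ((i.1 * i.2 : ℕ) : ZMod m) = ((j.1 * j.2 : ℕ) : ZMod m) := by
        push_cast
        linear_combination (-(i.1 : ZMod m) * i.2) * e2 + ((j.1 : ZMod m) * j.2) * e1
      rw [ZMod.natCast_eq_natCast_iff'] at e3
      simp only at h e3 ⊢
      rw [← Nat.div_add_mod (i.1 * i.2) m, ← Nat.div_add_mod (j.1 * j.2) m, h, e3]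

open ZMod in
lemma fourier_main {ι : Type*} (m : ℕ) [NeZero m] (hm : 2 ≤ m) (Q : Finset ι) (g : ι → ZMod m) (R : ℝ)
    (hR : ∀ w, ((Q.filter (fun i => g i = w)).card : ℝ) ≤ R) (b : ZMod m) (hb : IsUnit b) (Y : ℕ) :
    |(∑ i ∈ Q, ∑ j ∈ Q, ∑ v ∈ Finset.Icc 1 Y, if b * g i * g j = (v : ZMod m) then (1 : ℝ) else 0)
      - (Q.card : ℝ) ^ 2 * Y / m| ≤
    Real.sqrt m * (R * Q.card) * (m.divisors.card * (1 + Real.log m)) := by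
  have hm0 : (0 : ℝ) < m := by exact_mod_cast (by omega : 0 < m)
  set S : ZMod m → ℂ := fun h => ∑ i ∈ Q, ∑ j ∈ Q, stdAddChar (h * b * g i * g j) with hS
  set V : ZMod m → ℂ := fun h => ∑ v ∈ Finset.Icc 1 Y, stdAddChar (-(h * (v : ZMod m))) with hV
  set T : ℝ := ∑ i ∈ Q, ∑ j ∈ Q, ∑ v ∈ Finset.Icc 1 Y,
    if b * g i * g j = (v : ZMod m) then (1 : ℝ) else 0 with hT
  have hR0 : 0 ≤ R := le_trans (by positivity) (hR 0)
  have h1 : (m : ℂ) * (T : ℂ) = ∑ h, V h * S h := by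
    have e : ∀ h, V h * S h = ∑ i ∈ Q, ∑ j ∈ Q, ∑ v ∈ Finset.Icc 1 Y,
        stdAddChar (h * (b * g i * g j - (v : ZMod m))) := by
      intro h
      change (∑ v ∈ Finset.Icc 1 Y, stdAddChar (-(h * (v : ZMod m)))) *
        (∑ i ∈ Q, ∑ j ∈ Q, stdAddChar (h * b * g i * g j)) = _
      rw [Finset.mul_sum]
      refine Finset.sum_congr rfl fun i _ => ?_
      rw [Finset.mul_sum]
      refine Finset.sum_congr rfl fun j _ => ?_
      rw [Finset.sum_mul]
      refine Finset.sum_congr rfl fun v _ => ?_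
      rw [← AddChar.map_add_eq_mul]
      congr 1; ring
    rw [Finset.sum_congr rfl (fun h _ => e h), Finset.sum_comm, hT]
    push_cast
    rw [Finset.mul_sum]
    refine Finset.sum_congr rfl fun i _ => ?_
    rw [Finset.mul_sum, Finset.sum_comm]
    refine Finset.sum_congr rfl fun j _ => ?_
    rw [Finset.sum_comm, Finset.mul_sum]
    refine Finset.sum_congr rfl fun v _ => ?_
    rw [AddChar.sum_mulShift _ (isPrimitive_stdAddChar m), ZMod.card]
    simp only [sub_eq_zero]
    split_ifs <;> simp
  have h2 : ∑ h, V h * S h = ∑ n ∈ Finset.range m, V (n : ZMod m) * S (n : ZMod m) := by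
    symm
    refine Finset.sum_bij' (fun n _ => (n : ZMod m)) (fun h _ => h.val) ?_ ?_ ?_ ?_ ?_
    · intro n _; simp
    · intro h _; simpa using ZMod.val_lt h
    · intro n hn; exact ZMod.val_cast_of_lt (by simpa using hn)
    · intro h _; simp
    · intro n _; rfl
  have h3 : ∑ n ∈ Finset.range m, V (n : ZMod m) * S (n : ZMod m) =
      (Q.card : ℂ) ^ 2 * Y + ∑ n ∈ Finset.Ico 1 m, V (n : ZMod m) * S (n : ZMod m) := by
    rw [Finset.range_eq_Ico, Finset.sum_eq_sum_Ico_succ_bot (by omega)]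
    congr 1
    simp [hV, hS]
    ring
  have h4 : ‖∑ n ∈ Finset.Ico 1 m, V (n : ZMod m) * S (n : ZMod m)‖ ≤
      m * (Real.sqrt m * (R * Q.card) * (m.divisors.card * (1 + Real.log m))) := by
    calc _ ≤ ∑ n ∈ Finset.Ico 1 m, (m / 2 * (1 / n + 1 / (m - n : ℝ))) *
          (Real.sqrt m * (Nat.gcd n m : ℕ) * (R * Q.card)) := by
          refine (norm_sum_le _ _).trans (Finset.sum_le_sum fun n hn => ?_)
          obtain ⟨hn1, hn2⟩ := Finset.mem_Ico.1 hn
          rw [norm_mul]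
          have b1 := geo_bound m n hn1 hn2 Y
          have b2 := bilin' m Q g R hR ((n : ZMod m) * b) (Nat.gcd n m) (ann_card m n b hb)
          exact mul_le_mul b1 b2 (norm_nonneg _) ((norm_nonneg _).trans b1)
      _ = (m / 2) * (Real.sqrt m * (R * Q.card)) * ((∑ n ∈ Finset.Ico 1 m, (Nat.gcd n m : ℝ) / n) +
            ∑ n ∈ Finset.Ico 1 m, (Nat.gcd n m : ℝ) / (m - n : ℝ)) := by
          rw [← Finset.sum_add_distrib, Finset.mul_sum]
          refine Finset.sum_congr rfl fun n _ => ?_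
          ring
      _ ≤ (m / 2) * (Real.sqrt m * (R * Q.card)) * (m.divisors.card * (1 + Real.log m) +
            m.divisors.card * (1 + Real.log m)) := by
          have := gcd_sum m hm
          have := gcd_sum' m hm
          gcongr
      _ = _ := by ring
  have h5 : ((m * T - (Q.card : ℝ) ^ 2 * Y : ℝ) : ℂ) =
      ∑ n ∈ Finset.Ico 1 m, V (n : ZMod m) * S (n : ZMod m) := by
    push_cast
    rw [h1, h2, h3]; ring
  rw [← h5, Complex.norm_real, Real.norm_eq_abs] at h4
  have h6 : m * |T - (Q.card : ℝ) ^ 2 * Y / m| = |m * T - (Q.card : ℝ) ^ 2 * Y| := by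
    rw [← abs_of_pos hm0, ← abs_mul, abs_of_pos hm0]
    congr 1; field_simp
  rw [← h6] at h4
  exact le_of_mul_le_mul_left h4 hm0

noncomputable def PP (m : ℕ) (x : ℝ) : Finset ℕ :=
  (Finset.range (⌊x⌋₊ + 1)).filter (fun p => p.Prime ∧ p.Coprime m)

lemma mem_PP (m : ℕ) (x : ℝ) (hx : 0 ≤ x) (p : ℕ) :
    p ∈ PP m x ↔ p.Prime ∧ (p : ℝ) ≤ x ∧ p.Coprime m := by
  simp only [PP, Finset.mem_filter, Finset.mem_range, Nat.lt_succ_iff, Nat.le_floor_iff hx]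
  tauto

lemma T4_eq (m : ℕ) [NeZero m] (a : ℤ) (x y : ℝ) (hx : 0 ≤ x) (hy : 0 ≤ y) :
    (T4 m a x y : ℝ) = ∑ i ∈ PP m x ×ˢ PP m x, ∑ j ∈ PP m x ×ˢ PP m x, ∑ v ∈ Finset.Icc 1 ⌊y⌋₊,
      if (a : ZMod m) * ((i.1 : ZMod m)⁻¹ * (i.2 : ZMod m)⁻¹) * ((j.1 : ZMod m)⁻¹ * (j.2 : ZMod m)⁻¹)
        = (v : ZMod m) then (1 : ℝ) else 0 := by
  have e : T4 m a x y = ((PP m x ×ˢ PP m x ×ˢ PP m x ×ˢ PP m x ×ˢ Finset.Icc 1 ⌊y⌋₊).filter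
      (fun t => (a : ZMod m) * ((t.1 : ZMod m)⁻¹ * (t.2.1 : ZMod m)⁻¹) *
        ((t.2.2.1 : ZMod m)⁻¹ * (t.2.2.2.1 : ZMod m)⁻¹) = (t.2.2.2.2 : ZMod m))).card := by
    rw [T4, ← Set.ncard_coe_finset]
    congr 1
    ext t
    simp only [Set.mem_ofPred_eq, Finset.coe_filter, Finset.mem_product, mem_PP m x hx,
      Finset.mem_Icc, Nat.le_floor_iff hy, ← ZMod.intCast_eq_intCast_iff, minv]
    push_cast
    simp only [ZMod.natCast_zmod_val]
    simp only [mul_assoc]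
    tauto
  rw [e, Finset.card_filter]
  push_cast
  simp only [Finset.sum_product]

lemma primePi_bounds (m : ℕ) (hm : m ≠ 0) (x : ℝ) (hx : 0 ≤ x) :
    (PP m x).card ≤ primePi x ∧ primePi x ≤ (PP m x).card + m.divisors.card ∧
      (primePi x : ℝ) ≤ x := by
  have e : primePi x = ((Finset.range (⌊x⌋₊ + 1)).filter Nat.Prime).card := by
    rw [primePi, ← Set.ncard_coe_finset]
    congr 1
    ext t
    simp only [Set.mem_ofPred_eq, Finset.coe_filter, Finset.mem_range, Nat.lt_succ_iff,
      Nat.le_floor_iff hx]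
    tauto
  rw [e]
  refine ⟨Finset.card_le_card ?_, ?_, ?_⟩
  · intro p hp
    simp only [PP, Finset.mem_filter] at hp ⊢
    exact ⟨hp.1, hp.2.1⟩
  · refine le_trans (Finset.card_le_card (t := PP m x ∪ m.divisors) ?_) (Finset.card_union_le _ _)
    intro p hp
    simp only [PP, Finset.mem_filter, Finset.mem_union, Nat.mem_divisors] at hp ⊢
    rcases Nat.coprime_or_dvd_of_prime hp.2 m with h | h
    · exact Or.inl ⟨hp.1, hp.2, h⟩
    · exact Or.inr ⟨h, hm⟩
  · refine le_trans ?_ (Nat.floor_le hx)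
    have : ((Finset.range (⌊x⌋₊ + 1)).filter Nat.Prime) ⊆ Finset.Icc 1 ⌊x⌋₊ := by
      intro p hp
      simp only [Finset.mem_filter, Finset.mem_range, Finset.mem_Icc] at hp ⊢
      exact ⟨hp.2.one_lt.le, by omega⟩
    have := Finset.card_le_card this
    simp at this
    exact_mod_cast this

set_option maxHeartbeats 1000000 in
theorem stmt_14 : ∀ ε : ℝ, 0 < ε → ∃ C : ℝ, 0 < C ∧ ∀ m : ℕ, 2 ≤ m → ∀ x y : ℝ,
    (m : ℝ) ^ ((1 : ℝ) / 2) ≤ x → x ≤ m → 1 ≤ y → y ≤ m →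
    ∀ a : ℤ, Int.gcd a m = 1 →
    |(T4 m a x y : ℝ) - (primePi x : ℝ) ^ 4 * y / m|
      ≤ C * x ^ ((4 : ℝ) + ε) * (m : ℝ) ^ (-(1 : ℝ) / 2) := by
  intro ε hε
  set δ := ε / 4 with hδ
  have hδ0 : 0 < δ := by positivity
  obtain ⟨C, hC, hτ⟩ := tau_bound δ hδ0
  refine ⟨9 * (C * (1 + 1 / δ)), by positivity, ?_⟩
  intro m hm x y hmx hxm hy hym a ha
  have : NeZero m := ⟨by omega⟩
  have hm0 : (0 : ℝ) < m := by exact_mod_cast (by omega : 0 < m)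
  have hm1 : (1 : ℝ) ≤ m := by exact_mod_cast (by omega : 1 ≤ m)
  rw [← Real.sqrt_eq_rpow] at hmx
  set s := Real.sqrt m with hs
  have hs1 : 1 ≤ s := Real.one_le_sqrt.2 hm1
  have hs2 : s * s = m := Real.mul_self_sqrt hm0.le
  have hx0 : 0 < x := by linarith
  have hmx2 : (m : ℝ) ≤ x ^ 2 := by rw [← hs2]; nlinarith
  set P := PP m x with hP
  set Y := ⌊y⌋₊ with hY
  have hYy : (Y : ℝ) ≤ y := Nat.floor_le (by linarith)
  have hYy' : y < Y + 1 := Nat.lt_floor_add_one y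
  set t : ℝ := (m.divisors.card : ℝ) with ht
  have ht1 : 1 ≤ t := by
    rw [ht]; exact_mod_cast Finset.card_pos.2 ⟨1, by simp; omega⟩
  set L : ℝ := 1 + Real.log m with hL
  have hL1 : 1 ≤ L := by have := Real.log_nonneg hm1; linarith
  obtain ⟨q1, q2, q3⟩ := primePi_bounds m (by omega) x hx0.le
  set π' : ℝ := (primePi x : ℝ) with hπ
  set N : ℝ := (P.card : ℝ) with hN
  have q1' : N ≤ π' := by rw [hN, hπ]; exact_mod_cast q1
  have q2' : π' ≤ N + t := by rw [hN, hπ, ht]; exact_mod_cast q2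
  have hN0 : 0 ≤ N := by positivity
  -- Fourier part
  have hb : IsUnit (a : ZMod m) := by
    rw [ZMod.coe_int_isUnit_iff_isCoprime, isCoprime_comm, Int.isCoprime_iff_gcd_eq_one]
    exact ha
  have hR : ∀ w : ZMod m, (((P ×ˢ P).filter
      (fun i => ((i.1 : ZMod m)⁻¹ * (i.2 : ZMod m)⁻¹) = w)).card : ℝ) ≤ 4 * (x ^ 2 / m) := by
    intro w
    have h := fibre m ⌊x⌋₊ P (fun p hp => by
      have := (mem_PP m x hx0.le p).1 hp
      exact ⟨this.1, Nat.le_floor this.2.1, this.2.2⟩) w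
    have h' : (((P ×ˢ P).filter
      (fun i => ((i.1 : ZMod m)⁻¹ * (i.2 : ZMod m)⁻¹) = w)).card : ℝ) ≤
        2 * (((⌊x⌋₊ * ⌊x⌋₊ / m : ℕ) : ℝ) + 1) := by exact_mod_cast h
    have hf : (⌊x⌋₊ : ℝ) ≤ x := Nat.floor_le hx0.le
    have h2 : ((⌊x⌋₊ * ⌊x⌋₊ / m : ℕ) : ℝ) ≤ x ^ 2 / m := by
      refine Nat.cast_div_le.trans ?_
      push_cast
      rw [sq]
      gcongr
    have h3 : 1 ≤ x ^ 2 / m := by rwa [le_div_iff₀ hm0, one_mul]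
    linarith
  have hF := fourier_main m hm (P ×ˢ P) (fun i => (i.1 : ZMod m)⁻¹ * (i.2 : ZMod m)⁻¹) _ hR a hb Y
  rw [← T4_eq m a x y hx0.le (by linarith), Finset.card_product] at hF
  push_cast at hF
  rw [← hN, ← hs, ← ht, ← hL] at hF
  have hNx : N ≤ x := q1'.trans q3
  have hF' : |(T4 m a x y : ℝ) - N ^ 4 * Y / m| ≤ 4 * (x ^ 4 / s) * (t * L) := by
    have e1 : (N * N) ^ 2 = N ^ 4 := by ring
    rw [e1] at hF
    refine hF.trans ?_
    have : s * (4 * (x ^ 2 / m) * (N * N)) ≤ s * (4 * (x ^ 2 / m) * (x * x)) := by gcongr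
    calc _ ≤ s * (4 * (x ^ 2 / m) * (x * x)) * (t * L) := by gcongr
      _ = _ := by rw [← hs2]; field_simp
  have hM : |N ^ 4 * Y / m - π' ^ 4 * y / m| ≤ (x ^ 4 / s) * (1 + 4 * t) := by
    have hpp : 0 ≤ π' := hN0.trans q1'
    have a1 : π' ^ 4 - N ^ 4 ≤ 4 * x ^ 3 * t := by
      have : π' ^ 4 - N ^ 4 = (π' - N) * (π' ^ 3 + π' ^ 2 * N + π' * N ^ 2 + N ^ 3) := by ring
      rw [this]
      have b : π' ^ 3 + π' ^ 2 * N + π' * N ^ 2 + N ^ 3 ≤ x ^ 3 + x ^ 2 * x + x * x ^ 2 + x ^ 3 := by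
        gcongr
      calc _ ≤ t * (x ^ 3 + x ^ 2 * x + x * x ^ 2 + x ^ 3) :=
            mul_le_mul (by linarith) b (by positivity) (by linarith)
        _ = _ := by ring
    have a0 : N ^ 4 ≤ π' ^ 4 := by gcongr
    have a2 : N ^ 4 * Y ≤ π' ^ 4 * y := by gcongr
    have a3 : π' ^ 4 * y - N ^ 4 * Y ≤ x ^ 4 + 4 * x ^ 3 * t * m := by
      have : π' ^ 4 * y - N ^ 4 * Y = π' ^ 4 * (y - Y) + (π' ^ 4 - N ^ 4) * Y := by ring
      rw [this]
      have c1 : π' ^ 4 * (y - Y) ≤ x ^ 4 * 1 :=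
        mul_le_mul (by gcongr) (by linarith) (by linarith) (by positivity)
      have c2 : (π' ^ 4 - N ^ 4) * Y ≤ 4 * x ^ 3 * t * m :=
        mul_le_mul a1 (by linarith) (by positivity) (by positivity)
      linarith
    rw [abs_sub_comm, ← sub_div, abs_of_nonneg (by apply div_nonneg <;> linarith), div_le_iff₀ hm0]
    refine a3.trans ?_
    have e : x ^ 4 / s * (1 + 4 * t) * m = x ^ 4 * s + 4 * x ^ 3 * t * (x * s) := by
      rw [← hs2]; field_simp
    rw [e]
    have : x ^ 4 ≤ x ^ 4 * s := le_mul_of_one_le_right (by positivity) hs1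
    have : 4 * x ^ 3 * t * m ≤ 4 * x ^ 3 * t * (x * s) := by
      rw [← hs2]; gcongr
    linarith
  have htL : t * L ≤ C * (1 + 1 / δ) * x ^ ε := by
    have l1 : Real.log m ≤ (m : ℝ) ^ δ / δ := Real.log_le_rpow_div hm0.le hδ0
    have l2 : 1 ≤ (m : ℝ) ^ δ := Real.one_le_rpow hm1 hδ0.le
    have l3 : L ≤ (1 + 1 / δ) * (m : ℝ) ^ δ := by
      rw [hL, add_mul, one_mul, div_mul_eq_mul_div, one_mul]; linarith
    have l4 := hτ m (by omega)
    have l5 : (m : ℝ) ^ δ * (m : ℝ) ^ δ ≤ x ^ ε := by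
      rw [← Real.rpow_add hm0]
      calc (m : ℝ) ^ (δ + δ) ≤ (x ^ 2) ^ (δ + δ) := Real.rpow_le_rpow hm0.le hmx2 (by positivity)
        _ = x ^ ε := by
          rw [← Real.rpow_natCast, ← Real.rpow_mul hx0.le]
          congr 1; rw [hδ]; push_cast; ring
    calc t * L ≤ (C * (m : ℝ) ^ δ) * ((1 + 1 / δ) * (m : ℝ) ^ δ) := by gcongr
      _ = C * (1 + 1 / δ) * ((m : ℝ) ^ δ * (m : ℝ) ^ δ) := by ring
      _ ≤ _ := by gcongr
  have hfin : x ^ ((4 : ℝ) + ε) * (m : ℝ) ^ (-(1 : ℝ) / 2) = x ^ 4 / s * x ^ ε := by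
    rw [Real.rpow_add hx0, neg_div, Real.rpow_neg hm0.le, ← Real.sqrt_eq_rpow, ← hs]
    rw [show (4 : ℝ) = ((4 : ℕ) : ℝ) by norm_num, Real.rpow_natCast]
    ring
  rw [mul_assoc (9 * _), hfin]
  clear_value t L N π' s
  have htri := abs_sub_le (T4 m a x y : ℝ) (N ^ 4 * Y / m) (π' ^ 4 * y / m)
  have hK : 0 ≤ x ^ 4 / s := by positivity
  have h1 : 1 ≤ t * L := by nlinarith
  have h2 : t ≤ t * L := le_mul_of_one_le_right (by linarith) hL1
  calc _ ≤ 4 * (x ^ 4 / s) * (t * L) + (x ^ 4 / s) * (1 + 4 * t) := by linarith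
    _ ≤ (x ^ 4 / s) * (9 * (t * L)) := by
        have := mul_le_mul_of_nonneg_left (show 1 + 4 * t ≤ 5 * (t * L) by linarith) hK
        linarith
    _ ≤ (x ^ 4 / s) * (9 * (C * (1 + 1 / δ) * x ^ ε)) := by gcongr
    _ = _ := by ring
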